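/- Let D be a km × km diagonal real matrix with all diagonal entries positive. Then the Schur-complement matrix A := G D Gᵀ − (G D Fᵀ)(F D Fᵀ)⁻¹(F D Gᵀ) ∈ ℝ^{(m−1)×(m−1)} is symmetric positive definite and strictly diagonally dominant. -/

import Mathlib

open Matrix Kronecker

/-- The all-ones column vector `1_n` as an `n × 1` matrix. -/
def onesCol (n : ℕ) : Matrix (Fin n) (Fin 1) ℝ := fun _ _ => 1

/-- The `(m-1) × m` matrix `[0_{(m-1)×1} | I_{m-1}]` whose first column is zero and whose
remaining columns form the identity. -/
def padId (m : ℕ) : Matrix (Fin (m - 1)) (Fin m) ℝ :=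
  fun r j => if (j : ℕ) = (r : ℕ) + 1 then 1 else 0

/-- `F = I_k ⊗ 1_mᵀ ∈ ℝ^{k × km}` (the row index `Fin k × Fin 1` of the Kronecker
product is identified with `Fin k`). -/
def Fmat (k m : ℕ) : Matrix (Fin k) (Fin k × Fin m) ℝ :=
  Matrix.reindex (Equiv.prodUnique (Fin k) (Fin 1)) (Equiv.refl _)
    ((1 : Matrix (Fin k) (Fin k) ℝ) ⊗ₖ (onesCol m)ᵀ)

/-- `G = 1_kᵀ ⊗ [0_{(m-1)×1} | I_{m-1}] ∈ ℝ^{(m-1) × km}` (the row index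
`Fin 1 × Fin (m-1)` of the Kronecker product is identified with `Fin (m-1)`). -/
def Gmat (k m : ℕ) : Matrix (Fin (m - 1)) (Fin k × Fin m) ℝ :=
  Matrix.reindex (Equiv.uniqueProd (Fin (m - 1)) (Fin 1)) (Equiv.refl _)
    ((onesCol k)ᵀ ⊗ₖ padId m)

/-- A real square matrix `M` is strictly diagonally dominant if for every row `i`,
`|M_{ii}| > ∑_{j ≠ i} |M_{ij}|`. -/
def StrictDiagDominant {n : Type*} [Fintype n] [DecidableEq n]
    (M : Matrix n n ℝ) : Prop :=
  ∀ i, ∑ j ∈ Finset.univ.erase i, |M i j| < |M i i|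

/-- A real symmetric strictly diagonally dominant matrix with positive diagonal is positive
definite, by Gershgorin's circle theorem. -/
theorem StrictDiagDominant.posDef {n : Type*} [Fintype n] [DecidableEq n] {M : Matrix n n ℝ}
    (hM : StrictDiagDominant M) (hsymm : M.IsHermitian) (hdiag : ∀ i, 0 < M i i) :
    M.PosDef := by
  rw [hsymm.posDef_iff_eigenvalues_pos]
  intro i
  have hev : Module.End.HasEigenvalue (Matrix.toLin' M) (hsymm.eigenvalues i) := by
    rw [Module.End.hasEigenvalue_iff_mem_spectrum, Matrix.spectrum_toLin']
    exact hsymm.eigenvalues_mem_spectrum_real i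
  obtain ⟨r, hr⟩ := eigenvalue_mem_ball hev
  have hrow := hM r
  rw [abs_of_pos (hdiag r)] at hrow
  simp only [Metric.mem_closedBall, Real.dist_eq, Real.norm_eq_abs] at hr
  linarith [(abs_le.mp hr).1]

/-- For a positive array `c` with row sums less than `s`, the matrix
`diag (∑ l, c l) - ∑ l, (c l) (c l)ᵀ / s l` is positive definite and strictly diagonally
dominant. -/
theorem posDef_strictDiagDominant_of_sum_lt {ι n : Type*} [Fintype ι] [Nonempty ι] [Fintype n]
    [DecidableEq n] {A : Matrix n n ℝ} {c : ι → n → ℝ} {s : ι → ℝ} (hc : ∀ l i, 0 < c l i)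
    (hs : ∀ l, ∑ i, c l i < s l)
    (hA : ∀ i j, A i j = (if i = j then ∑ l, c l i else 0) - ∑ l, c l i * c l j / s l) :
    A.PosDef ∧ StrictDiagDominant A := by
  have hs0 (l : ι) : 0 < s l := (Finset.sum_nonneg fun i _ => (hc l i).le).trans_lt (hs l)
  have habs (i j : n) (hij : j ≠ i) : |A i j| = ∑ l, c l i * c l j / s l := by
    rw [hA, if_neg hij.symm, zero_sub, abs_neg, abs_of_nonneg]
    exact Finset.sum_nonneg fun l _ => (div_pos (mul_pos (hc l i) (hc l j)) (hs0 l)).le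
  have hrow (i : n) : ∑ j ∈ Finset.univ.erase i, |A i j| < A i i := by
    rw [Finset.sum_congr rfl fun j hj => habs i j (Finset.ne_of_mem_erase hj), hA, if_pos rfl,
      lt_sub_iff_add_lt, Finset.sum_erase_add _ _ (Finset.mem_univ i), Finset.sum_comm]
    refine Finset.sum_lt_sum_of_nonempty Finset.univ_nonempty fun l _ => ?_
    rw [← Finset.sum_div, ← Finset.mul_sum, div_lt_iff₀ (hs0 l)]
    exact mul_lt_mul_of_pos_left (hs l) (hc l i)
  have hdiag (i : n) : 0 < A i i :=
    (Finset.sum_nonneg fun j _ => abs_nonneg (A i j)).trans_lt (hrow i)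
  have hdom : StrictDiagDominant A := fun i => by
    rw [abs_of_pos (hdiag i)]
    exact hrow i
  refine ⟨hdom.posDef ?_ hdiag, hdom⟩
  ext i j
  rw [conjTranspose_apply, star_trivial]
  by_cases hij : i = j
  · rw [hij]
  · simp only [hA, if_neg hij, if_neg (Ne.symm hij), mul_comm (c _ j)]

/-- The column of `padId m` holding the nonzero entry of row `r`. -/
def padIdCol (m : ℕ) (r : Fin (m - 1)) : Fin m := ⟨r + 1, by omega⟩

theorem padIdCol_injective (m : ℕ) : Function.Injective (padIdCol m) := by
  intro a b h
  simpa [padIdCol, Fin.ext_iff] using h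

theorem sum_padIdCol_lt {m : ℕ} (hm : 0 < m) {f : Fin m → ℝ} (hf : ∀ p, 0 < f p) :
    ∑ r, f (padIdCol m r) < ∑ p, f p := by
  rw [← Finset.sum_image (s := Finset.univ) (g := padIdCol m) (f := f)
    (padIdCol_injective m).injOn]
  refine Finset.sum_lt_sum_of_subset (Finset.subset_univ _) (Finset.mem_univ ⟨0, hm⟩) ?_ (hf _)
    fun p _ _ => (hf p).le
  simp [padIdCol, Fin.ext_iff]

theorem Gmat_apply (k m : ℕ) (r : Fin (m - 1)) (x : Fin k × Fin m) :
    Gmat k m r x = if x.2 = padIdCol m r then 1 else 0 := by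
  simp [Gmat, onesCol, padId, padIdCol, Fin.ext_iff, kroneckerMap_apply]

theorem Fmat_apply (k m : ℕ) (l : Fin k) (x : Fin k × Fin m) :
    Fmat k m l x = if l = x.1 then 1 else 0 := by
  simp [Fmat, onesCol, kroneckerMap_apply, Matrix.one_apply]

theorem Gmat_mul_diagonal_mul_transpose_Gmat (k m : ℕ) (d : Fin k × Fin m → ℝ) :
    Gmat k m * diagonal d * (Gmat k m)ᵀ =
      diagonal fun i => ∑ l, d (l, padIdCol m i) := by
  ext i j
  rw [Matrix.mul_apply]
  by_cases hij : i = j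
  · simp [mul_diagonal, Gmat_apply, Fintype.sum_prod_type, hij]
  · simp [mul_diagonal, Gmat_apply, Fintype.sum_prod_type, hij, Ne.symm hij,
      (padIdCol_injective m).eq_iff]

theorem Gmat_mul_diagonal_mul_transpose_Fmat (k m : ℕ) (d : Fin k × Fin m → ℝ) :
    Gmat k m * diagonal d * (Fmat k m)ᵀ = of fun i l => d (l, padIdCol m i) := by
  ext i l
  rw [Matrix.mul_apply]
  simp [mul_diagonal, Gmat_apply, Fmat_apply, Fintype.sum_prod_type]

theorem Fmat_mul_diagonal_mul_transpose_Gmat (k m : ℕ) (d : Fin k × Fin m → ℝ) :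
    Fmat k m * diagonal d * (Gmat k m)ᵀ = of fun l i => d (l, padIdCol m i) := by
  ext l i
  rw [Matrix.mul_apply]
  simp [mul_diagonal, Gmat_apply, Fmat_apply, Fintype.sum_prod_type]

theorem Fmat_mul_diagonal_mul_transpose_Fmat (k m : ℕ) (d : Fin k × Fin m → ℝ) :
    Fmat k m * diagonal d * (Fmat k m)ᵀ = diagonal fun l => ∑ p, d (l, p) := by
  ext l l'
  rw [Matrix.mul_apply]
  by_cases hl : l = l'
  · simp [mul_diagonal, Fmat_apply, Fintype.sum_prod_type, hl]
  · simp [mul_diagonal, Fmat_apply, Fintype.sum_prod_type, hl]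

/-- For any `km × km` diagonal matrix `D` with strictly positive diagonal entries, the
Schur complement `A = G D Gᵀ − (G D Fᵀ)(F D Fᵀ)⁻¹(F D Gᵀ)` is symmetric positive
definite and strictly diagonally dominant. -/
theorem schur_complement_posDef_strictDiagDominant (k m : ℕ) (hk : 0 < k) (hm : 2 ≤ m)
    (d : Fin k × Fin m → ℝ) (hd : ∀ i, 0 < d i) :
    (Gmat k m * Matrix.diagonal d * (Gmat k m)ᵀ -
        (Gmat k m * Matrix.diagonal d * (Fmat k m)ᵀ) *
          (Fmat k m * Matrix.diagonal d * (Fmat k m)ᵀ)⁻¹ *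
          (Fmat k m * Matrix.diagonal d * (Gmat k m)ᵀ)).PosDef ∧
    StrictDiagDominant
      (Gmat k m * Matrix.diagonal d * (Gmat k m)ᵀ -
        (Gmat k m * Matrix.diagonal d * (Fmat k m)ᵀ) *
          (Fmat k m * Matrix.diagonal d * (Fmat k m)ᵀ)⁻¹ *
          (Fmat k m * Matrix.diagonal d * (Gmat k m)ᵀ)) := by
  have : Nonempty (Fin k) := ⟨⟨0, hk⟩⟩
  have hs (l : Fin k) : ∑ i, d (l, padIdCol m i) < ∑ p, d (l, p) :=
    sum_padIdCol_lt (by omega) fun p => hd (l, p)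
  have hs0 (l : Fin k) : ∑ p, d (l, p) ≠ 0 :=
    ((Finset.sum_nonneg fun i _ => (hd (l, padIdCol m i)).le).trans_lt (hs l)).ne'
  have hinv : (diagonal fun l => ∑ p, d (l, p))⁻¹ = diagonal fun l => (∑ p, d (l, p))⁻¹ := by
    refine Matrix.inv_eq_right_inv ?_
    simp [diagonal_mul_diagonal, hs0]
  rw [Gmat_mul_diagonal_mul_transpose_Gmat, Gmat_mul_diagonal_mul_transpose_Fmat,
    Fmat_mul_diagonal_mul_transpose_Gmat, Fmat_mul_diagonal_mul_transpose_Fmat, hinv]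
  refine posDef_strictDiagDominant_of_sum_lt (fun l i => hd (l, padIdCol m i)) hs fun i j => ?_
  rw [Matrix.sub_apply, diagonal_apply, Matrix.mul_apply]
  simp only [mul_diagonal, of_apply, div_eq_mul_inv, mul_right_comm]
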